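/- Let M > 0, λ ∈ (0,1), and b ≥ 2 an integer. Suppose w_q ∈ [λM, M], set r = M − w_q, and let ŵ_q be any real number with ŵ_q ≥ w_q − r/(2(2^b − 1)). Then for every x with 0 ≤ x ≤ λM, one has x − ŵ_q/2 ≤ ( λ/2 + (1 − λ)/(4(2^b − 1)) )·M. -/

import Mathlib

/-- The low-resolution error inequality (equation (15)) in the proof of Lemma 1:
if `w_q ∈ [λM, M]`, `r = M - w_q`, and `ŵ_q ≥ w_q - r/(2(2^b-1))`, then for every
`x ∈ [0, λM]` one has `x - ŵ_q/2 ≤ (λ/2 + (1-λ)/(4(2^b-1))) M`. -/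
theorem low_resolution_error_bound
    (M lam : ℝ) (b : ℕ) (hM : 0 < M) (hlam : lam ∈ Set.Ioo (0:ℝ) 1) (hb : 2 ≤ b)
    (wq whatq : ℝ) (hwq : wq ∈ Set.Icc (lam * M) M)
    (r : ℝ) (hr : r = M - wq)
    (hwhatq : wq - r / (2 * ((2:ℝ) ^ b - 1)) ≤ whatq) :
    ∀ x : ℝ, 0 ≤ x → x ≤ lam * M →
      x - whatq / 2 ≤ (lam / 2 + (1 - lam) / (4 * ((2:ℝ) ^ b - 1))) * M := by
  intro x _ hx
  subst hr
  have hpow : (1 : ℝ) < 2 ^ b := one_lt_pow₀ one_lt_two (by lia)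
  have hinv : 0 < ((2 : ℝ) ^ b - 1)⁻¹ := inv_pos.2 (sub_pos.2 hpow)
  have hquant : (M - wq) / (2 * ((2 : ℝ) ^ b - 1)) = (M - wq) * ((2 : ℝ) ^ b - 1)⁻¹ / 2 := by
    rw [div_eq_mul_inv, mul_inv]
    ring
  have hbound : (1 - lam) / (4 * ((2 : ℝ) ^ b - 1)) = (1 - lam) * ((2 : ℝ) ^ b - 1)⁻¹ / 4 := by
    rw [div_eq_mul_inv, mul_inv]
    ring
  rw [hquant] at hwhatq
  rw [hbound]
  have hstep := mul_le_mul_of_nonneg_right hwq.1 hinv.le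
  linarith [hwq.1]
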